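/- arXiv:2504.04218 — 4 statements merged into one kernel-verified Lean document; each statement's English description precedes it below -/
import Mathlib

section
/- Let X, A, A' be preordered sets, R : X → A and R' : A → A' monotone maps, and μ : X → Prop monotone. Then A is reducible to A' along R' (i.e., for every a ∈ A, (↑(R' ∘ R) μ)(R' a) ↔ (↑R μ) a and (↓(R' ∘ R) μ)(R' a) ↔ (↓R μ) a) if and only if for all a, b ∈ A with R' a ≤ R' b, one has ((↑R μ) a → (↑R μ) b) and ((↓R μ) a → (↓R μ) b). -/
/-- The upper approximation of `μ : X → Prop` along a monotone `R : X → A`. -/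
def upperApprox {X A : Type*} [Preorder X] [Preorder A] (R : X → A) (μ : X → Prop) :
    A → Prop :=
  fun a => ∃ x, R x ≤ a ∧ μ x

/-- The lower approximation of `μ : X → Prop` along a monotone `R : X → A`. -/
def lowerApprox {X A : Type*} [Preorder X] [Preorder A] (R : X → A) (μ : X → Prop) :
    A → Prop :=
  fun a => ∀ x, a ≤ R x → μ x

/-- `A` is reducible to `A'` along `R'` (with respect to `R` and `μ`). -/
def Reducible {X A A' : Type*} [Preorder X] [Preorder A] [Preorder A']
    (R : X → A) (R' : A → A') (μ : X → Prop) : Prop :=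
  ∀ a, (upperApprox (R' ∘ R) μ (R' a) ↔ upperApprox R μ a) ∧
       (lowerApprox (R' ∘ R) μ (R' a) ↔ lowerApprox R μ a)

/-- Algebraic characterization of reducibility: `A` is reducible to `A'` along `R'` iff
`R' a ≤ R' b` implies `(↑R μ) a ≤ (↑R μ) b` and `(↓R μ) a ≤ (↓R μ) b`. -/
theorem reducible_iff
    {X A A' : Type*} [Preorder X] [Preorder A] [Preorder A']
    (R : X → A) (R' : A → A') (hR : Monotone R) (hR' : Monotone R')
    (μ : X → Prop) (hμ : Monotone μ) :
    Reducible R R' μ ↔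
      ∀ a b, R' a ≤ R' b →
        ((upperApprox R μ a → upperApprox R μ b) ∧
         (lowerApprox R μ a → lowerApprox R μ b)) := by
  constructor
  · intro h a b hab
    refine ⟨fun ha => (h b).1.1 ?_, fun ha => (h b).2.1 ?_⟩
    · obtain ⟨x, hx, hm⟩ := (h a).1.2 ha
      exact ⟨x, hx.trans hab, hm⟩
    · intro x hx
      exact (h a).2.2 ha x (hab.trans hx)
  · intro h a
    refine ⟨⟨?_, ?_⟩, ⟨?_, ?_⟩⟩
    · rintro ⟨x, hx, hm⟩
      exact (h (R x) a hx).1 ⟨x, le_rfl, hm⟩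
    · rintro ⟨x, hx, hm⟩
      exact ⟨x, hR' hx, hm⟩
    · intro ha x hx
      exact ha x (hR' hx)
    · intro ha x hx
      exact (h a (R x) hx).2 ha x le_rfl
end

section
/- Let L be a complete commutative residuated lattice, and let X, A be types equipped with e_X : X → X → L and e_A : A → A → L each satisfying 1 ≤ e a a and e b c * e a b ≤ e a c. Let R : X → A satisfy e_X x y ≤ e_A (R x) (R y), and let μ : X → L satisfy e_X x y * μ x ≤ μ y. Define D : A → L by D a = ⨅ (x : X), (e_A a (R x) ⇨ μ x). Then: (i) e_A a b * D a ≤ D b for all a, b (D is an L-enriched functor into L); and (ii) for every ν : A → L with e_A a b * ν a ≤ ν b, one has ⨅ (a : A), (ν a ⇨ D a) = ⨅ (x : X), (ν (R x) ⇨ μ x); that is, D is the L-enriched lower approximation, a right L-enriched adjoint of ν ↦ ν ∘ R. -/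
/-- The `L`-enriched lower approximation `D a = ⨅ x, (e_A a (R x) ⇨ μ x)` of an enriched
functor `μ : X → L` along an enriched functor `R : X → A` is an enriched functor into
`L`, and it is a right `L`-enriched adjoint of `ν ↦ ν ∘ R`:
`⨅ a, (ν a ⇨ D a) = ⨅ x, (ν (R x) ⇨ μ x)` for every enriched functor `ν : A → L`. -/
theorem enriched_lower_approximation
    {L : Type*} [CompleteLattice L] [CommMonoid L]
    (himp : L → L → L) (adj : ∀ p q r : L, p * q ≤ r ↔ q ≤ himp p r)
    {X A : Type*}
    (eX : X → X → L) (eA : A → A → L)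
    (eX_refl : ∀ a, 1 ≤ eX a a) (eX_trans : ∀ a b c, eX b c * eX a b ≤ eX a c)
    (eA_refl : ∀ a, 1 ≤ eA a a) (eA_trans : ∀ a b c, eA b c * eA a b ≤ eA a c)
    (R : X → A) (hR : ∀ x y, eX x y ≤ eA (R x) (R y))
    (μ : X → L) (hμ : ∀ x y, eX x y * μ x ≤ μ y) :
    (∀ a b, eA a b * (⨅ x, himp (eA a (R x)) (μ x)) ≤ ⨅ x, himp (eA b (R x)) (μ x)) ∧
    (∀ ν : A → L, (∀ a b, eA a b * ν a ≤ ν b) →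
      (⨅ a, himp (ν a) (⨅ x, himp (eA a (R x)) (μ x))) = ⨅ x, himp (ν (R x)) (μ x)) := by
  have ml : ∀ p q q' : L, q ≤ q' → p * q ≤ p * q' := fun p q q' h =>
    (adj _ _ _).2 (h.trans ((adj _ _ _).1 le_rfl))
  have mr : ∀ p p' q : L, p ≤ p' → p * q ≤ p' * q := fun p p' q h => by
    rw [mul_comm p, mul_comm p']
    exact ml _ _ _ h
  have ev : ∀ a x, eA a (R x) * (⨅ x, himp (eA a (R x)) (μ x)) ≤ μ x := fun a x =>
    (adj _ _ _).2 (iInf_le _ x)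
  refine ⟨fun a b => le_iInf fun x => (adj _ _ _).1 ?_, fun ν hν => le_antisymm ?_ ?_⟩
  · rw [← mul_assoc]
    exact (mr _ _ _ (eA_trans a b (R x))).trans (ev a x)
  · refine le_iInf fun x => (adj _ _ _).1 ?_
    have h1 : ν (R x) * (⨅ a, himp (ν a) (⨅ x, himp (eA a (R x)) (μ x)))
        ≤ ⨅ y, himp (eA (R x) (R y)) (μ y) := (adj _ _ _).2 (iInf_le _ (R x))
    have h2 := mr _ _ (⨅ y, himp (eA (R x) (R y)) (μ y)) (eA_refl (R x))
    rw [one_mul] at h2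
    exact h1.trans (h2.trans (ev (R x) x))
  · refine le_iInf fun a => (adj _ _ _).1 (le_iInf fun x => (adj _ _ _).1 ?_)
    rw [← mul_assoc]
    exact (mr _ _ _ (hν a (R x))).trans ((adj _ _ _).2 (iInf_le _ x))
end

section
/- Let L be a complete commutative residuated lattice, and let X, A, A' be types equipped with e_X, e_A, e_{A'} each satisfying 1 ≤ e a a and e b c * e a b ≤ e a c. Let R : X → A and R' : A → A' satisfy e_X x y ≤ e_A (R x) (R y) and e_A a b ≤ e_{A'} (R' a) (R' b). Then for every μ : X → L and every a' ∈ A': ⨆ (a : A), e_{A'} (R' a) a' * (⨆ (x : X), e_A (R x) a * μ x) = ⨆ (x : X), e_{A'} (R' (R x)) a' * μ x, and ⨅ (a : A), (e_{A'} a' (R' a) ⇨ ⨅ (x : X), (e_A a (R x) ⇨ μ x)) = ⨅ (x : X), (e_{A'} a' (R' (R x)) ⇨ μ x); that is, L-enriched upper and lower approximations are closed under composition: ↑R' ∘ ↑R = ↑(R' ∘ R) and ↓R' ∘ ↓R = ↓(R' ∘ R). -/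
/-- `L`-enriched upper and lower approximations are closed under composition:
`↑R' (↑R μ) = ↑(R' ∘ R) μ` and `↓R' (↓R μ) = ↓(R' ∘ R) μ`, written pointwise. -/
theorem enriched_approx_comp
    {L : Type*} [CompleteLattice L] [CommMonoid L]
    (himp : L → L → L) (adj : ∀ p q r : L, p * q ≤ r ↔ q ≤ himp p r)
    {X A A' : Type*}
    (eX : X → X → L) (eA : A → A → L) (eA' : A' → A' → L)
    (eX_refl : ∀ a, 1 ≤ eX a a) (eX_trans : ∀ a b c, eX b c * eX a b ≤ eX a c)
    (eA_refl : ∀ a, 1 ≤ eA a a) (eA_trans : ∀ a b c, eA b c * eA a b ≤ eA a c)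
    (eA'_refl : ∀ a, 1 ≤ eA' a a) (eA'_trans : ∀ a b c, eA' b c * eA' a b ≤ eA' a c)
    (R : X → A) (hR : ∀ x y, eX x y ≤ eA (R x) (R y))
    (R' : A → A') (hR' : ∀ a b, eA a b ≤ eA' (R' a) (R' b))
    (μ : X → L) (a' : A') :
    ((⨆ a, eA' (R' a) a' * ⨆ x, eA (R x) a * μ x) =
      ⨆ x, eA' (R' (R x)) a' * μ x) ∧
    ((⨅ a, himp (eA' a' (R' a)) (⨅ x, himp (eA a (R x)) (μ x))) =
      ⨅ x, himp (eA' a' (R' (R x))) (μ x)) := by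
  have ml : ∀ p q q' : L, q ≤ q' → p * q ≤ p * q' := fun p q q' h =>
    (adj _ _ _).2 (h.trans ((adj _ _ _).1 le_rfl))
  have mr : ∀ p p' q : L, p ≤ p' → p * q ≤ p' * q := fun p p' q h => by
    rw [mul_comm p, mul_comm p']; exact ml _ _ _ h
  have one : ∀ a (q : L), q ≤ eA a a * q := fun a q => by
    simpa using mr _ _ q (eA_refl a)
  refine ⟨le_antisymm ?_ ?_, le_antisymm ?_ ?_⟩
  · refine iSup_le fun a => (adj _ _ _).2 (iSup_le fun x => (adj _ _ _).1 ?_)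
    rw [← mul_assoc]
    refine le_trans (mr _ _ _ ?_) (le_iSup (fun x => eA' (R' (R x)) a' * μ x) x)
    exact (ml _ _ _ (hR' _ _)).trans (eA'_trans _ _ _)
  · refine iSup_le fun x => ?_
    refine le_trans (ml _ _ _ ?_)
      (le_iSup (fun a => eA' (R' a) a' * ⨆ x, eA (R x) a * μ x) (R x))
    exact (one (R x) _).trans (le_iSup (fun y => eA (R y) (R x) * μ y) x)
  · refine le_iInf fun x => (adj _ _ _).1 ((one (R x) _).trans ((adj _ _ _).2 ?_))
    refine le_trans ((adj _ _ _).2 (iInf_le _ (R x))) (iInf_le _ x)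
  · refine le_iInf fun a => (adj _ _ _).1 (le_iInf fun x => (adj _ _ _).1 ?_)
    rw [← mul_assoc]
    refine le_trans (mr _ _ _ ?_) ((adj _ _ _).2 (iInf_le _ x))
    exact (mr _ _ _ (hR' _ _)).trans (eA'_trans _ _ _)
end

section
/- Let L be a complete commutative residuated lattice, and let X, A be types equipped with e_X and e_A each satisfying 1 ≤ e a a and e b c * e a b ≤ e a c, and let R : X → A satisfy e_X x y ≤ e_A (R x) (R y). Then for all μ, ν : X → L and every a ∈ A: (↓R (fun x => μ x ⊓ ν x)) a = (↓R μ) a ⊓ (↓R ν) a and (↑R (fun x => μ x ⊔ ν x)) a = (↑R μ) a ⊔ (↑R ν) a; that is, the enriched lower approximation preserves binary meets and the enriched upper approximation preserves binary joins. -/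
/-- The `L`-enriched lower approximation `(↓R μ) a = ⨅ x, (e_A a (R x) ⇨ μ x)` preserves
binary meets and the `L`-enriched upper approximation `(↑R μ) a = ⨆ x, e_A (R x) a * μ x`
preserves binary joins. -/
theorem enriched_approx_meet_join
    {L : Type*} [CompleteLattice L] [CommMonoid L]
    (himp : L → L → L) (adj : ∀ p q r : L, p * q ≤ r ↔ q ≤ himp p r)
    {X A : Type*}
    (eX : X → X → L) (eA : A → A → L)
    (eX_refl : ∀ a, 1 ≤ eX a a) (eX_trans : ∀ a b c, eX b c * eX a b ≤ eX a c)
    (eA_refl : ∀ a, 1 ≤ eA a a) (eA_trans : ∀ a b c, eA b c * eA a b ≤ eA a c)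
    (R : X → A) (hR : ∀ x y, eX x y ≤ eA (R x) (R y))
    (μ ν : X → L) (a : A) :
    ((⨅ x, himp (eA a (R x)) (μ x ⊓ ν x)) =
      (⨅ x, himp (eA a (R x)) (μ x)) ⊓ (⨅ x, himp (eA a (R x)) (ν x))) ∧
    ((⨆ x, eA (R x) a * (μ x ⊔ ν x)) =
      (⨆ x, eA (R x) a * μ x) ⊔ (⨆ x, eA (R x) a * ν x)) := by
  have gc : ∀ p : L, GaloisConnection (fun q => p * q) (himp p) := fun p q r => adj p q r
  constructor
  · rw [← iInf_inf_eq]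
    exact iInf_congr fun x => (gc (eA a (R x))).u_inf
  · rw [← iSup_sup_eq]
    exact iSup_congr fun x => (gc (eA (R x) a)).l_sup
end
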